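/- Let μ, ν be probability measures on ℝ with μ ⊞-infinitely divisible. Then the subordination distribution μ ⊳ ν is ⊞-infinitely divisible, and for every t ≥ 0, (μ ⊳ ν)^{⊞t} = μ^{⊞t} ⊳ ν. -/

import Mathlib

open MeasureTheory Complex

noncomputable section

/-- The Cauchy transform `G_μ(z) = ∫ 1/(z - x) dμ(x)` of a measure on `ℝ`. -/
def cauchyG (μ : Measure ℝ) (z : ℂ) : ℂ := ∫ x : ℝ, (z - (x : ℂ))⁻¹ ∂μ

/-- The F-transform `F_μ = 1/G_μ`. -/
def Ftr (μ : Measure ℝ) (z : ℂ) : ℂ := (cauchyG μ z)⁻¹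

/-- The open upper half-plane `ℂ⁺`. -/
def UHP : Set ℂ := {z : ℂ | 0 < z.im}

/-- The truncated cone `Γ_{α,M} = {z ∈ ℂ⁺ : |Re z| < α · Im z, Im z > M}`. -/
def tcone (α M : ℝ) : Set ℂ := {z : ℂ | |z.re| < α * z.im ∧ M < z.im}

/-- `φ` is a Voiculescu transform of `μ`: `φ(F_μ(z)) + F_μ(z) = z` on some truncated cone. -/
def IsVT (μ : Measure ℝ) (φ : ℂ → ℂ) : Prop :=
  ∃ α M : ℝ, 0 < α ∧ 0 < M ∧ ∀ z ∈ tcone α M, φ (Ftr μ z) + Ftr μ z = z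

/-- `ψ` is a two-state Voiculescu transform of the pair `(μt, μ)`:
`ψ(F_μ(z)) + F_{μt}(z) = z` on some truncated cone. -/
def IsTwoStateVT (μt μ : Measure ℝ) (ψ : ℂ → ℂ) : Prop :=
  ∃ α M : ℝ, 0 < α ∧ 0 < M ∧ ∀ z ∈ tcone α M, ψ (Ftr μ z) + Ftr μt z = z

/-- `μ` is freely infinitely divisible: some Voiculescu transform `φ` of `μ` is such that
`t·φ` is a Voiculescu transform of a probability measure for every `t ≥ 0`. -/
def IsFID (μ : Measure ℝ) : Prop :=
  ∃ φ : ℂ → ℂ, IsVT μ φ ∧ ∀ t : ℝ, 0 ≤ t →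
    ∃ ν : Measure ℝ, IsProbabilityMeasure ν ∧ IsVT ν (fun z => (t : ℂ) * φ z)

/-- The semicircular distribution with mean `β` and variance `γ` (Dirac mass at `β` for `γ = 0`). -/
def semicircle (β γ : ℝ) : Measure ℝ :=
  if γ = 0 then Measure.dirac β
  else volume.withDensity
    (fun x => ENNReal.ofReal ((2 * Real.pi * γ)⁻¹ * Real.sqrt (4 * γ - (x - β) ^ 2)))

section

open Filter Topology Set Metric

lemma UHP_isOpen : IsOpen UHP := isOpen_lt continuous_const continuous_im

lemma UHP_isPreconnected : IsPreconnected UHP := (convex_halfSpace_im_gt 0).isPreconnected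

lemma tcone_subset_UHP {α M : ℝ} (hM : 0 < M) : tcone α M ⊆ UHP := fun _ hz => hM.trans hz.2

lemma im_le_norm_sub_ofReal (z : ℂ) (x : ℝ) : z.im ≤ ‖z - x‖ := by
  simpa using (le_abs_self _).trans (abs_im_le_norm (z - x))

lemma norm_inv_sub_ofReal_le {z : ℂ} (hz : 0 < z.im) (x : ℝ) :
    ‖(z - x)⁻¹‖ ≤ z.im⁻¹ := by
  rw [norm_inv]
  exact inv_anti₀ hz (im_le_norm_sub_ofReal z x)

lemma sub_ofReal_ne_zero {z : ℂ} (hz : 0 < z.im) (x : ℝ) : z - x ≠ 0 :=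
  norm_pos_iff.1 (hz.trans_le (im_le_norm_sub_ofReal z x))

lemma continuous_inv_sub_ofReal {z : ℂ} (hz : 0 < z.im) :
    Continuous fun x : ℝ => (z - x)⁻¹ :=
  (continuous_const.sub continuous_ofReal).inv₀ (sub_ofReal_ne_zero hz)

lemma integrable_inv_sub_ofReal (μ : Measure ℝ) [IsFiniteMeasure μ] {z : ℂ} (hz : 0 < z.im) :
    Integrable (fun x : ℝ => (z - x)⁻¹) μ :=
  Integrable.of_bound (continuous_inv_sub_ofReal hz).aestronglyMeasurable z.im⁻¹
    (Eventually.of_forall (norm_inv_sub_ofReal_le hz))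

lemma integrable_sq_norm_inv_sub_ofReal (μ : Measure ℝ) [IsFiniteMeasure μ] {z : ℂ}
    (hz : 0 < z.im) : Integrable (fun x : ℝ => ‖(z - x)⁻¹‖ ^ 2) μ := by
  refine Integrable.of_bound
    ((continuous_inv_sub_ofReal hz).norm.pow 2).aestronglyMeasurable (z.im⁻¹ ^ 2)
    (Eventually.of_forall fun x => ?_)
  rw [Real.norm_of_nonneg (by positivity)]
  gcongr
  exact norm_inv_sub_ofReal_le hz x

lemma norm_cauchyG_le (μ : Measure ℝ) [IsProbabilityMeasure μ] {z : ℂ} (hz : 0 < z.im) :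
    ‖cauchyG μ z‖ ≤ z.im⁻¹ := by
  simpa [cauchyG] using norm_integral_le_of_norm_le_const (μ := μ)
    (Eventually.of_forall (norm_inv_sub_ofReal_le hz))

lemma differentiableOn_cauchyG (μ : Measure ℝ) [IsFiniteMeasure μ] :
    DifferentiableOn ℂ (cauchyG μ) UHP := by
  have h := (analyticOn_resolventTransform (μ := μ)).differentiableOn.neg.mono
    (s := UHP) fun z (hz : 0 < z.im) => by
      rintro ⟨x, -, rfl⟩
      simp at hz
  refine h.congr fun z hz => ?_
  simp only [cauchyG, Pi.neg_apply, resolventTransform_apply, ← integral_neg]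
  refine integral_congr_ae (Eventually.of_forall fun x => ?_)
  simp only [resolvent, Ring.inverse_eq_inv', Complex.coe_algebraMap]
  rw [← inv_neg, neg_sub]

lemma im_inv_sub_ofReal (z : ℂ) (x : ℝ) : ((z - x)⁻¹).im = -(z.im * ‖(z - x)⁻¹‖ ^ 2) := by
  rw [inv_im, norm_inv, inv_pow, ← normSq_eq_norm_sq]
  simp [div_eq_mul_inv]

lemma im_cauchyG (μ : Measure ℝ) [IsFiniteMeasure μ] {z : ℂ} (hz : 0 < z.im) :
    (cauchyG μ z).im = -(z.im * ∫ x : ℝ, ‖(z - x)⁻¹‖ ^ 2 ∂μ) := by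
  have := integral_im (integrable_inv_sub_ofReal μ hz)
  rw [cauchyG, ← integral_const_mul, ← integral_neg]
  simp only [← im_inv_sub_ofReal]
  exact this.symm

lemma im_cauchyG_neg (μ : Measure ℝ) [IsProbabilityMeasure μ] {z : ℂ} (hz : 0 < z.im) :
    (cauchyG μ z).im < 0 := by
  rw [im_cauchyG μ hz, neg_lt_zero]
  refine mul_pos hz ?_
  rw [integral_pos_iff_support_of_nonneg (fun x => by positivity)
    (integrable_sq_norm_inv_sub_ofReal μ hz)]
  have : Function.support (fun x : ℝ => ‖(z - x)⁻¹‖ ^ 2) = univ := by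
    ext x
    simp [sub_ofReal_ne_zero hz x]
  rw [this]
  simp

lemma cauchyG_ne_zero (μ : Measure ℝ) [IsProbabilityMeasure μ] {z : ℂ} (hz : 0 < z.im) :
    cauchyG μ z ≠ 0 := fun h => by simpa [h] using im_cauchyG_neg μ hz

lemma differentiableOn_Ftr (μ : Measure ℝ) [IsProbabilityMeasure μ] :
    DifferentiableOn ℂ (Ftr μ) UHP :=
  (differentiableOn_cauchyG μ).inv fun _ hz => cauchyG_ne_zero μ hz

lemma im_le_im_Ftr (μ : Measure ℝ) [IsProbabilityMeasure μ] {z : ℂ} (hz : 0 < z.im) :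
    z.im ≤ (Ftr μ z).im := by
  have h1 : ‖cauchyG μ z‖ ^ 2 ≤ ∫ x : ℝ, ‖(z - x)⁻¹‖ ^ 2 ∂μ := by
    calc ‖cauchyG μ z‖ ^ 2 ≤ (∫ x : ℝ, ‖(z - x)⁻¹‖ ∂μ) ^ 2 := by
          gcongr
          exact norm_integral_le_integral_norm _
      _ ≤ _ := (even_two.convexOn_pow (𝕜 := ℝ)).map_integral_le
          (continuous_pow 2).continuousOn isClosed_univ (Eventually.of_forall fun _ => mem_univ _)
          (integrable_inv_sub_ofReal μ hz).norm (integrable_sq_norm_inv_sub_ofReal μ hz)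
  have h2 : 0 < ‖cauchyG μ z‖ ^ 2 := by
    have := norm_pos_iff.2 (cauchyG_ne_zero μ hz)
    positivity
  rw [Ftr, inv_im, im_cauchyG μ hz, neg_neg, normSq_eq_norm_sq, le_div_iff₀ h2]
  gcongr

lemma tendsto_integral_min_atTop (μ : Measure ℝ) [IsFiniteMeasure μ] (C : ℝ) (hC : 0 ≤ C) :
    Tendsto (fun y : ℝ => ∫ x : ℝ, min (|x| / y) C ∂μ) atTop (𝓝 0) := by
  have : Tendsto (fun y : ℝ => ∫ x : ℝ, min (|x| / y) C ∂μ) atTop (𝓝 (∫ _ : ℝ, (0 : ℝ) ∂μ)) := by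
    refine tendsto_integral_filter_of_dominated_convergence (fun _ => C)
      (Eventually.of_forall fun y => Continuous.aestronglyMeasurable (by fun_prop)) ?_
      (integrable_const C) (Eventually.of_forall fun x => ?_)
    · filter_upwards [eventually_gt_atTop 0] with y hy
      refine Eventually.of_forall fun x => ?_
      rw [Real.norm_of_nonneg (le_min (by positivity) hC)]
      exact min_le_right _ _
    · have h1 : Tendsto (fun y : ℝ => |x| / y) atTop (𝓝 0) := tendsto_const_nhds.div_atTop tendsto_id
      simpa [hC] using h1.min (tendsto_const_nhds (x := C))
  simpa using this

lemma norm_le_of_mem_tcone {α M : ℝ} {z : ℂ} (hM : 0 < M) (hz : z ∈ tcone α M) :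
    ‖z‖ ≤ (1 + α) * z.im := by
  have h := norm_le_abs_re_add_abs_im z
  have hz' : 0 < z.im := hM.trans hz.2
  rw [abs_of_pos hz'] at h
  linarith [hz.1]

lemma exists_norm_mul_cauchyG_sub_one_le (μ : Measure ℝ) [IsProbabilityMeasure μ] {α ε : ℝ}
    (hα : 0 < α) (hε : 0 < ε) :
    ∃ M, 0 < M ∧ ∀ z ∈ tcone α M, ‖z * cauchyG μ z - 1‖ ≤ ε := by
  have h := tendsto_integral_min_atTop μ (2 + α) (by positivity)
  obtain ⟨M, hM⟩ := eventually_atTop.1 (h.eventually (gt_mem_nhds hε))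
  refine ⟨max M 1, by positivity, fun z hz => ?_⟩
  have hz0 : 0 < z.im := lt_of_lt_of_le one_pos ((le_max_right _ _).trans hz.2.le)
  have hzn := norm_le_of_mem_tcone (by positivity) hz
  have hi := integrable_inv_sub_ofReal μ hz0
  have heq : z * cauchyG μ z - 1 = ∫ x : ℝ, x * (z - x)⁻¹ ∂μ := by
    have h1 : (1 : ℂ) = ∫ _ : ℝ, (1 : ℂ) ∂μ := by simp
    rw [cauchyG, ← integral_const_mul, h1, ← integral_sub (hi.const_mul z) (integrable_const _)]
    refine integral_congr_ae (Eventually.of_forall fun x => ?_)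
    have := sub_ofReal_ne_zero hz0 x
    dsimp only
    field_simp
    ring
  rw [heq]
  refine (norm_integral_le_of_norm_le (g := fun x => min (|x| / z.im) (2 + α)) ?_
    (Eventually.of_forall fun x => ?_)).trans (hM _ ((le_max_left _ _).trans hz.2.le)).le
  · refine Integrable.of_bound (Continuous.aestronglyMeasurable (by fun_prop)) (2 + α)
      (Eventually.of_forall fun x => ?_)
    rw [Real.norm_of_nonneg (le_min (by positivity) (by positivity))]
    exact min_le_right _ _
  · have hn := norm_inv_sub_ofReal_le hz0 x
    refine le_min ?_ ?_
    · rw [norm_mul, norm_real, Real.norm_eq_abs, div_eq_mul_inv]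
      gcongr
    · have : (x : ℂ) * (z - x)⁻¹ = z * (z - x)⁻¹ - 1 := by
        have := sub_ofReal_ne_zero hz0 x
        field_simp
        ring
      rw [this]
      calc ‖z * (z - x)⁻¹ - 1‖ ≤ ‖z‖ * ‖(z - x)⁻¹‖ + 1 := by
            simpa using norm_sub_le (z * (z - x)⁻¹) 1
        _ ≤ ((1 + α) * z.im) * z.im⁻¹ + 1 := by gcongr
        _ = 2 + α := by field_simp; ring

lemma exists_norm_Ftr_sub_le (μ : Measure ℝ) [IsProbabilityMeasure μ] {α ε : ℝ}
    (hα : 0 < α) (hε : 0 < ε) :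
    ∃ M, 0 < M ∧ ∀ z ∈ tcone α M, ‖Ftr μ z - z‖ ≤ ε * z.im := by
  set η := min (1 / 2) (ε / (2 * (1 + α))) with hη
  have hη0 : 0 < η := by positivity
  obtain ⟨M, hM, h⟩ := exists_norm_mul_cauchyG_sub_one_le μ hα hη0
  refine ⟨M, hM, fun z hz => ?_⟩
  have hz0 : 0 < z.im := hM.trans hz.2
  have hzn := norm_le_of_mem_tcone hM hz
  have hG := cauchyG_ne_zero μ hz0
  have h1 := h z hz
  have hz1 : z ≠ 0 := by rintro rfl; simp at hz0
  have h2 : 1 / 2 ≤ ‖z * cauchyG μ z‖ := by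
    have := norm_sub_norm_le 1 (z * cauchyG μ z)
    rw [norm_sub_rev, norm_one] at this
    have := h1.trans (min_le_left _ _)
    linarith
  have heq : Ftr μ z - z = -(z * (z * cauchyG μ z - 1) / (z * cauchyG μ z)) := by
    rw [Ftr]; field_simp; ring
  rw [heq, norm_neg, norm_div, norm_mul, div_le_iff₀ (by positivity)]
  calc ‖z‖ * ‖z * cauchyG μ z - 1‖ ≤ ((1 + α) * z.im) * (ε / (2 * (1 + α))) := by
        gcongr
        exact h1.trans (min_le_right _ _)
    _ = ε * z.im * (1 / 2) := by field_simp
    _ ≤ _ := by gcongr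

lemma norm_sub_le_of_norm_le_on_ball {f : ℂ → ℂ} {c : ℂ} {r C : ℝ} (hr : 0 < r)
    (hd : DifferentiableOn ℂ f (ball c (2 * r))) (hC : ∀ z ∈ ball c (2 * r), ‖f z‖ ≤ C)
    {x y : ℂ} (hx : x ∈ ball c r) (hy : y ∈ ball c r) : ‖f x - f y‖ ≤ C / r * ‖x - y‖ := by
  have hsub : ∀ p ∈ ball c r, closedBall p r ⊆ ball c (2 * r) := fun p hp =>
    closedBall_subset_ball' (by linarith [mem_ball.1 hp])
  refine (convex_ball c r).norm_image_sub_le_of_norm_deriv_le (𝕜 := ℂ) (fun p hp => ?_)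
    (fun p hp => ?_) hy hx
  · exact hd.differentiableAt (isOpen_ball.mem_nhds (hsub p hp (mem_closedBall_self hr.le)))
  · exact norm_deriv_le_of_forall_mem_sphere_norm_le hr
      ((hd.mono (hsub p hp)).diffContOnCl_ball subset_rfl)
      fun z hz => hC z (hsub p hp (sphere_subset_closedBall hz))

lemma exists_ultrafilter_limit {f : ℕ → ℂ → ℂ} (hd : ∀ n, DifferentiableOn ℂ (f n) UHP)
    (hb : ∀ n, ∀ z ∈ UHP, ‖f n z‖ ≤ z.im⁻¹) :
    ∃ (U : Ultrafilter ℕ) (g : ℂ → ℂ), (U : Filter ℕ) ≤ atTop ∧ DifferentiableOn ℂ g UHP ∧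
      ∀ z ∈ UHP, Tendsto (fun n => f n z) U (𝓝 (g z)) := by
  let U : Ultrafilter ℕ := hyperfilter ℕ
  have hex : ∀ z : ℂ, ∃ l : ℂ, z ∈ UHP → Tendsto (fun n => f n z) U (𝓝 l) := by
    intro z
    by_cases hz : z ∈ UHP
    · obtain ⟨l, -, hl⟩ := (isCompact_closedBall (0 : ℂ) z.im⁻¹).ultrafilter_le_nhds'
        (U.map fun n => f n z)
        (Ultrafilter.mem_map.2 (Eventually.of_forall fun n => by simpa using hb n z hz))
      exact ⟨l, fun _ => hl⟩
    · exact ⟨0, fun h => absurd h hz⟩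
  choose g hg using hex
  refine ⟨U, g, Nat.hyperfilter_le_atTop, ?_, hg⟩
  have : TendstoLocallyUniformlyOn f g U UHP := by
    rw [Metric.tendstoLocallyUniformlyOn_iff]
    intro ε hε x hx
    have hx0 : 0 < x.im := hx
    set r := x.im / 4 with hrdef
    have hr : 0 < r := by positivity
    have him : ∀ z ∈ ball x (2 * r), x.im / 2 ≤ z.im := by
      intro z hz
      have h1 := (abs_im_le_norm (z - x)).trans (mem_ball_iff_norm.1 hz).le
      rw [sub_im] at h1
      linarith [(abs_le.1 h1).1]
    have hsub : ball x (2 * r) ⊆ UHP := fun z hz => lt_of_lt_of_le (by positivity) (him z hz)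
    have hrr : ball x r ⊆ ball x (2 * r) := ball_subset_ball (by linarith)
    set K := (x.im / 2)⁻¹ / r
    have hK : 0 < K := by positivity
    have hlip : ∀ n, ∀ y ∈ ball x r, ‖f n y - f n x‖ ≤ K * ‖y - x‖ := fun n y hy =>
      norm_sub_le_of_norm_le_on_ball hr ((hd n).mono hsub)
        (fun z hz => (hb n z (hsub hz)).trans (inv_anti₀ (by positivity) (him z hz))) hy
        (mem_ball_self hr)
    have hlip' : ∀ y ∈ ball x r, ‖g y - g x‖ ≤ K * ‖y - x‖ := fun y hy =>
      le_of_tendsto ((hg y (hsub (hrr hy))).sub (hg x hx)).norm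
        (Eventually.of_forall fun n => hlip n y hy)
    refine ⟨ball x (min r (ε / (4 * K))),
      mem_nhdsWithin_of_mem_nhds (ball_mem_nhds _ (by positivity)), ?_⟩
    filter_upwards [(Metric.tendsto_nhds.1 (hg x hx)) (ε / 2) (by positivity)] with n hn y hy
    have hy1 : y ∈ ball x r := ball_subset_ball (min_le_left _ _) hy
    have hy2 : K * ‖y - x‖ ≤ ε / 4 := by
      have h1 : ‖y - x‖ ≤ ε / (4 * K) := (mem_ball_iff_norm.1 hy).le.trans (min_le_right _ _)
      calc K * ‖y - x‖ ≤ K * (ε / (4 * K)) := by gcongr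
        _ = ε / 4 := by field_simp
    have h1 := hlip n y hy1
    have h2 := hlip' y hy1
    rw [← dist_eq_norm] at h1 h2
    have h3 := dist_triangle4 (g y) (g x) (f n x) (f n y)
    rw [dist_comm (g x), dist_comm (f n x) (f n y)] at h3
    linarith
  exact this.differentiableOn (Eventually.of_forall hd) UHP_isOpen

lemma poissonKernel_zero_circleMap (w : ℂ) (θ : ℝ) :
    poissonKernel 0 w (circleMap 0 1 θ) = (1 - ‖w‖ ^ 2) / ‖circleMap 0 1 θ - w‖ ^ 2 := by
  simp [poissonKernel_def]

lemma circleMap_sub_ne_zero {w : ℂ} (hw : w ∈ ball (0 : ℂ) 1) (θ : ℝ) :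
    circleMap 0 1 θ - w ≠ 0 := by
  intro h
  have := sub_eq_zero.1 h
  rw [← this] at hw
  simp at hw

lemma continuous_poissonKernel_circleMap {w : ℂ} (hw : w ∈ ball (0 : ℂ) 1) :
    Continuous fun θ : ℝ => poissonKernel 0 w (circleMap 0 1 θ) := by
  simp only [poissonKernel_zero_circleMap]
  refine continuous_const.div (by fun_prop) fun θ => ?_
  simpa using circleMap_sub_ne_zero hw θ

lemma norm_poissonKernel_circleMap_le {w : ℂ} (hw : w ∈ ball (0 : ℂ) 1) (θ : ℝ) :
    ‖poissonKernel 0 w (circleMap 0 1 θ)‖ ≤ 1 / (1 - ‖w‖) ^ 2 := by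
  have hw1 : ‖w‖ < 1 := by simpa using hw
  have h1 : 1 - ‖w‖ ≤ ‖circleMap 0 1 θ - w‖ := by
    simpa using norm_sub_norm_le (circleMap 0 1 θ) w
  rw [poissonKernel_zero_circleMap, Real.norm_of_nonneg
    (div_nonneg (by nlinarith [norm_nonneg w]) (by positivity))]
  gcongr
  nlinarith

lemma circleAverage_re_poissonKernel_mul {q : ℂ → ℂ} (hq : DiffContOnCl ℂ q (ball 0 1)) {w : ℂ}
    (hw : w ∈ ball (0 : ℂ) 1) :
    (2 * Real.pi)⁻¹ * ∫ θ in (0 : ℝ)..2 * Real.pi,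
      poissonKernel 0 w (circleMap 0 1 θ) * (q (circleMap 0 1 θ)).re = (q w).re := by
  have hcont : Continuous fun θ : ℝ => q (circleMap 0 1 θ) :=
    hq.continuousOn_ball.comp_continuous (by fun_prop) fun θ => by simp
  have hint : CircleIntegrable (poissonKernel 0 w • q) 0 1 :=
    ((continuous_poissonKernel_circleMap hw).smul hcont).intervalIntegrable _ _
  have h := reCLM.circleAverage_comp_comm hint
  rw [hq.circleAverage_poissonKernel_smul hw, Real.circleAverage_def, smul_eq_mul] at h
  simpa using h

/-- The measure on the angles given by the boundary values of the real part of `q`. -/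
def boundaryMeasure (q : ℂ → ℂ) : Measure ℝ :=
  (volume.restrict (Ioc 0 (2 * Real.pi))).withDensity
    fun θ => ENNReal.ofReal ((2 * Real.pi)⁻¹ * (q (circleMap 0 1 θ)).re)

lemma integral_boundaryMeasure {q : ℂ → ℂ} (hq : DiffContOnCl ℂ q (ball 0 1))
    (hre : ∀ z ∈ closedBall (0 : ℂ) 1, 0 ≤ (q z).re) {w : ℂ} (hw : w ∈ ball (0 : ℂ) 1) :
    ∫ θ, poissonKernel 0 w (circleMap 0 1 θ) ∂(boundaryMeasure q) = (q w).re := by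
  have hcont : Continuous fun θ : ℝ => q (circleMap 0 1 θ) :=
    hq.continuousOn_ball.comp_continuous (by fun_prop) fun θ => by simp
  have hmeas : Measurable fun θ : ℝ =>
      ENNReal.ofReal ((2 * Real.pi)⁻¹ * (q (circleMap 0 1 θ)).re) :=
    (ENNReal.continuous_ofReal.comp
      (continuous_const.mul (continuous_re.comp hcont))).measurable
  rw [boundaryMeasure, integral_withDensity_eq_integral_toReal_smul
    hmeas (Eventually.of_forall fun _ => ENNReal.ofReal_lt_top),
    ← circleAverage_re_poissonKernel_mul hq hw, ← intervalIntegral.integral_const_mul,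
    intervalIntegral.integral_of_le (by positivity)]
  refine integral_congr_ae (Eventually.of_forall fun θ => ?_)
  have : 0 ≤ (q (circleMap 0 1 θ)).re := hre _ (by simp)
  dsimp only
  rw [ENNReal.toReal_ofReal (by positivity), smul_eq_mul]
  ring

lemma boundaryMeasure_univ {q : ℂ → ℂ} (hq : DiffContOnCl ℂ q (ball 0 1))
    (hre : ∀ z ∈ closedBall (0 : ℂ) 1, 0 ≤ (q z).re) :
    boundaryMeasure q univ = ENNReal.ofReal (q 0).re := by
  have hcont : Continuous fun θ : ℝ => q (circleMap 0 1 θ) :=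
    hq.continuousOn_ball.comp_continuous (by fun_prop) fun θ => by simp
  have h := circleAverage_re_poissonKernel_mul hq (mem_ball_self one_pos)
  simp only [poissonKernel_zero_circleMap] at h
  rw [← intervalIntegral.integral_const_mul, intervalIntegral.integral_of_le (by positivity)] at h
  rw [boundaryMeasure, withDensity_apply _ MeasurableSet.univ, Measure.restrict_univ,
    ← ofReal_integral_eq_lintegral_ofReal, ← h]
  · simp
  · exact (continuous_const.mul (continuous_re.comp hcont)).integrableOn_Ioc
  · refine Eventually.of_forall fun θ => ?_
    have : 0 ≤ (q (circleMap 0 1 θ)).re := hre _ (by simp)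
    dsimp only
    positivity

/-- **Herglotz representation** of the real part of a holomorphic function with nonnegative real
part on the unit disc. -/
theorem exists_herglotz_measure {q : ℂ → ℂ} (hq : DifferentiableOn ℂ q (ball 0 1))
    (hre : ∀ z ∈ ball (0 : ℂ) 1, 0 ≤ (q z).re) :
    ∃ σ : Measure ℝ, IsFiniteMeasure σ ∧ ∀ w ∈ ball (0 : ℂ) 1,
      ∫ θ, poissonKernel 0 w (circleMap 0 1 θ) ∂σ = (q w).re := by
  let r : ℕ → ℝ := fun n => 1 - 1 / ((n : ℝ) + 2)
  have hr : ∀ n, 0 ≤ r n ∧ r n < 1 := fun n => by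
    have h1 : 1 / ((n : ℝ) + 2) ≤ 1 := by
      rw [div_le_one (by positivity)]
      linarith [n.cast_nonneg (α := ℝ)]
    have h2 : 0 < 1 / ((n : ℝ) + 2) := by positivity
    exact ⟨by simp only [r]; linarith, by simp only [r]; linarith⟩
  have hr1 : Tendsto r atTop (𝓝 1) := by
    have : Tendsto (fun n : ℕ => 1 / ((n : ℝ) + 2)) atTop (𝓝 0) :=
      tendsto_const_nhds.div_atTop (tendsto_atTop_add_const_right _ _ tendsto_natCast_atTop_atTop)
    have := (tendsto_const_nhds (x := (1 : ℝ))).sub this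
    rwa [sub_zero] at this
  let p : ℕ → ℂ → ℂ := fun n z => q (r n * z)
  have hmaps : ∀ n, ∀ z ∈ closedBall (0 : ℂ) 1, (r n : ℂ) * z ∈ ball (0 : ℂ) 1 := fun n z hz => by
    have hz : ‖z‖ ≤ 1 := by simpa using hz
    rw [mem_ball_zero_iff, norm_mul, norm_real, Real.norm_of_nonneg (hr n).1]
    nlinarith [hr n]
  have hp : ∀ n, DiffContOnCl ℂ (p n) (ball 0 1) := fun n =>
    (hq.comp (t := ball 0 1) (s := closedBall 0 1)
      (differentiable_id.const_mul (r n : ℂ)).differentiableOn (hmaps n)).diffContOnCl_ball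
      subset_rfl
  have hpre : ∀ n, ∀ z ∈ closedBall (0 : ℂ) 1, 0 ≤ (p n z).re := fun n z hz => hre _ (hmaps n z hz)
  have hmass : ∀ n, boundaryMeasure (p n) univ = ENNReal.ofReal (q 0).re := fun n => by
    simp [boundaryMeasure_univ (hp n) (hpre n), p]
  let σ : ℕ → FiniteMeasure ℝ := fun n =>
    ⟨boundaryMeasure (p n), ⟨by rw [hmass]; exact ENNReal.ofReal_lt_top⟩⟩
  have hK := isCompact_setOfPred_finiteMeasure_le_of_isCompact (E := ℝ) (q 0).re.toNNReal
    (isCompact_Icc (a := (0 : ℝ)) (b := 2 * Real.pi))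
  let U : Ultrafilter ℕ := hyperfilter ℕ
  obtain ⟨s, -, hs⟩ := hK.ultrafilter_le_nhds' (U.map σ)
    (Ultrafilter.mem_map.2 <| Eventually.of_forall fun n => by
    constructor
    · rw [← ENNReal.coe_le_coe, FiniteMeasure.ennreal_mass]
      exact (hmass n).le
    · rw [← ENNReal.coe_eq_zero, FiniteMeasure.ennreal_coeFn_eq_coeFn_toMeasure]
      refine withDensity_absolutelyContinuous _ _ ?_
      rw [Measure.restrict_apply measurableSet_Icc.compl]
      convert measure_empty (μ := (volume : Measure ℝ))
      ext x
      simp only [mem_inter_iff, mem_compl_iff, mem_Icc, mem_Ioc, mem_empty_iff_false, iff_false]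
      rintro ⟨h1, h2⟩
      exact h1 ⟨h2.1.le, h2.2⟩)
  have hs' : Tendsto σ U (𝓝 s) := hs
  refine ⟨s, inferInstance, fun w hw => ?_⟩
  have h1 := FiniteMeasure.tendsto_iff_forall_integral_tendsto.1 hs'
    (BoundedContinuousFunction.ofNormedAddCommGroup _ (continuous_poissonKernel_circleMap hw) _
      (norm_poissonKernel_circleMap_le hw))
  have h2 : Tendsto (fun n => (p n w).re) U (𝓝 (q w).re) := by
    refine (continuous_re.tendsto _).comp ?_
    refine Tendsto.comp (y := 𝓝 w)
      (hq.continuousOn.continuousAt (isOpen_ball.mem_nhds hw)) ?_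
    have : Tendsto (fun n => (r n : ℂ) * w) atTop (𝓝 (((1 : ℝ) : ℂ) * w)) :=
      ((continuous_ofReal.tendsto _).comp hr1).mul_const _
    simpa using this.mono_left Nat.hyperfilter_le_atTop
  refine tendsto_nhds_unique (h1.congr fun n => ?_) h2
  exact integral_boundaryMeasure (hp n) (hpre n) hw

lemma one_sub_ne_zero_of_mem_ball {w : ℂ} (hw : w ∈ ball (0 : ℂ) 1) : 1 - w ≠ 0 := by
  intro h
  rw [← sub_eq_zero.1 h] at hw
  simp at hw

lemma im_cayley {w : ℂ} (hw : 1 - w ≠ 0) :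
    (I * (1 + w) / (1 - w)).im = (1 - ‖w‖ ^ 2) / ‖1 - w‖ ^ 2 := by
  have h : ‖1 - w‖ ^ 2 ≠ 0 := by simpa using hw
  rw [div_im, normSq_eq_norm_sq]
  rw [← sub_div, div_left_inj' h, ← normSq_eq_norm_sq, normSq_apply]
  simp
  ring

lemma add_I_ne_zero {z : ℂ} (hz : 0 ≤ z.im) : z + I ≠ 0 := by
  intro h
  have := congrArg im h
  simp at this
  linarith

lemma one_sub_sq_norm_cayley {z : ℂ} (hz : 0 ≤ z.im) :
    1 - ‖(z - I) / (z + I)‖ ^ 2 = 4 * z.im / ‖z + I‖ ^ 2 := by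
  have h : ‖z + I‖ ^ 2 ≠ 0 := by simpa using add_I_ne_zero hz
  rw [norm_div, div_pow, one_sub_div h, div_left_inj' h, ← normSq_eq_norm_sq, ← normSq_eq_norm_sq,
    normSq_apply, normSq_apply]
  simp
  ring

lemma cayley_mem_ball {z : ℂ} (hz : 0 < z.im) : (z - I) / (z + I) ∈ ball (0 : ℂ) 1 := by
  have h : 0 < ‖z + I‖ := norm_pos_iff.2 (add_I_ne_zero hz.le)
  have h1 := one_sub_sq_norm_cayley hz.le
  have h2 : 0 < 4 * z.im / ‖z + I‖ ^ 2 := by positivity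
  rw [mem_ball_zero_iff, ← abs_of_nonneg (norm_nonneg _), ← sq_lt_one_iff_abs_lt_one]
  linarith

lemma cayley_cayley {z : ℂ} (hz : 0 < z.im) :
    I * (1 + (z - I) / (z + I)) / (1 - (z - I) / (z + I)) = z := by
  have h := add_I_ne_zero hz.le
  have h1 : 1 - (z - I) / (z + I) = 2 * I / (z + I) := by field_simp; ring
  rw [h1]
  field_simp
  ring

lemma poissonKernel_cayley_of_eq_one {z : ℂ} (hz : 0 < z.im) {θ : ℝ}
    (hθ : circleMap 0 1 θ = 1) :
    poissonKernel 0 ((z - I) / (z + I)) (circleMap 0 1 θ) = z.im := by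
  have h := add_I_ne_zero hz.le
  have h' : 0 < ‖z + I‖ := norm_pos_iff.2 h
  have h1 : 1 - (z - I) / (z + I) = 2 * I / (z + I) := by field_simp; ring
  rw [poissonKernel_zero_circleMap, one_sub_sq_norm_cayley hz.le, hθ, h1]
  simp
  field_simp
  norm_num

lemma poissonKernel_cayley {z : ℂ} (hz : 0 < z.im) {θ : ℝ} {x : ℝ}
    (hθ : circleMap 0 1 θ = (x - I) / (x + I)) :
    poissonKernel 0 ((z - I) / (z + I)) (circleMap 0 1 θ) =
      z.im * ((1 + x ^ 2) * ‖(z - x)⁻¹‖ ^ 2) := by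
  have h := add_I_ne_zero hz.le
  have hx : (x : ℂ) + I ≠ 0 := add_I_ne_zero (by simp)
  have h' : 0 < ‖z + I‖ := norm_pos_iff.2 h
  have hzx : 0 < ‖z - x‖ := norm_pos_iff.2 (sub_ofReal_ne_zero hz x)
  have h1 : (x - I) / (x + I) - (z - I) / (z + I) = -(2 * I * (z - x)) / ((x + I) * (z + I)) := by
    field_simp; ring
  have h2 : ‖(x : ℂ) + I‖ ^ 2 = 1 + x ^ 2 := by
    rw [← normSq_eq_norm_sq, normSq_apply]; simp; ring
  have h3 : 0 < ‖(x : ℂ) + I‖ := norm_pos_iff.2 hx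
  rw [poissonKernel_zero_circleMap, one_sub_sq_norm_cayley hz.le, hθ, h1, ← h2]
  simp
  field_simp
  norm_num

/-- The real number which the Cayley transform associates to a point of the unit circle. -/
def linePoint (θ : ℝ) : ℝ := (I * (1 + circleMap 0 1 θ) / (1 - circleMap 0 1 θ)).re

lemma measurable_linePoint : Measurable linePoint := by
  have h : Measurable (circleMap 0 1) := (continuous_circleMap 0 1).measurable
  exact measurable_re.comp (((measurable_const.add h).const_mul I).div (measurable_const.sub h))

lemma circleMap_eq_linePoint {θ : ℝ} (h : circleMap 0 1 θ ≠ 1) :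
    circleMap 0 1 θ = (linePoint θ - I) / (linePoint θ + I) := by
  have h1 : 1 - circleMap 0 1 θ ≠ 0 := sub_ne_zero.2 h.symm
  have h2 : (linePoint θ : ℂ) = I * (1 + circleMap 0 1 θ) / (1 - circleMap 0 1 θ) := by
    apply Complex.ext
    · simp [linePoint]
    · rw [im_cayley h1]; simp
  have h3 : (linePoint θ : ℂ) + I ≠ 0 := add_I_ne_zero (by simp)
  rw [eq_div_iff h3, h2]
  field_simp
  ring

lemma eqOn_of_im_eq {f g : ℂ → ℂ} (hf : DifferentiableOn ℂ f UHP) (hg : DifferentiableOn ℂ g UHP)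
    (him : ∀ z ∈ UHP, (f z).im = (g z).im)
    (hf0 : Tendsto (fun y : ℝ => f (y * I)) atTop (𝓝 0))
    (hg0 : Tendsto (fun y : ℝ => g (y * I)) atTop (𝓝 0)) : EqOn f g UHP := by
  obtain ⟨c, hc⟩ := ((hf.sub hg).analyticOnNhd UHP_isOpen).eq_const_of_im_eq_const (c₀ := 0)
    (fun z hz => by simp [him z hz]) UHP_isOpen ⟨⟨I, by simp [UHP]⟩, UHP_isPreconnected⟩
  have h1 : Tendsto (fun y : ℝ => f (y * I) - g (y * I)) atTop (𝓝 c) := by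
    refine tendsto_const_nhds.congr' ?_
    filter_upwards [eventually_gt_atTop 0] with y hy
    exact (hc _ (by simpa [UHP] using hy)).symm
  have h2 : c = 0 := tendsto_nhds_unique h1 (by simpa using hf0.sub hg0)
  intro z hz
  exact sub_eq_zero.1 ((hc z hz).trans h2)

lemma exists_integral_eq_neg_im {g : ℂ → ℂ} (hg : DifferentiableOn ℂ g UHP)
    (him : ∀ z ∈ UHP, (g z).im ≤ 0) :
    ∃ (σ : Measure ℝ) (m : ℝ) (_ : IsFiniteMeasure σ), 0 ≤ m ∧ ∀ z ∈ UHP,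
      Integrable (fun θ => z.im * ((1 + linePoint θ ^ 2) * ‖(z - linePoint θ)⁻¹‖ ^ 2)) σ ∧
      m * z.im + ∫ θ, z.im * ((1 + linePoint θ ^ 2) * ‖(z - linePoint θ)⁻¹‖ ^ 2) ∂σ
        = -(g z).im := by
  have hC : ∀ w ∈ ball (0 : ℂ) 1, I * (1 + w) / (1 - w) ∈ UHP := fun w hw => by
    have h1 := one_sub_ne_zero_of_mem_ball hw
    have h2 : ‖w‖ < 1 := by simpa using hw
    change 0 < (I * (1 + w) / (1 - w)).im
    rw [im_cayley h1]
    have := norm_pos_iff.2 h1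
    have : 0 < 1 - ‖w‖ ^ 2 := by nlinarith [norm_nonneg w]
    positivity
  obtain ⟨σ, hσ, h⟩ := exists_herglotz_measure (q := fun w => I * g (I * (1 + w) / (1 - w)))
    ((hg.comp (DifferentiableOn.div (by fun_prop) (by fun_prop)
      fun w hw => one_sub_ne_zero_of_mem_ball hw) hC).const_mul I)
    (fun w hw => by simpa using him _ (hC w hw))
  let A : Set ℝ := {θ | circleMap 0 1 θ = 1}
  have hA : MeasurableSet A :=
    (isClosed_eq (continuous_circleMap 0 1) continuous_const).measurableSet
  refine ⟨σ.restrict Aᶜ, σ.real A, inferInstance, measureReal_nonneg, fun z hz => ?_⟩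
  have hw := cayley_mem_ball hz
  have hi : Integrable (fun θ => poissonKernel 0 ((z - I) / (z + I)) (circleMap 0 1 θ)) σ :=
    Integrable.of_bound (continuous_poissonKernel_circleMap hw).aestronglyMeasurable _
      (Eventually.of_forall (norm_poissonKernel_circleMap_le hw))
  have hc : EqOn (fun θ => poissonKernel 0 ((z - I) / (z + I)) (circleMap 0 1 θ))
      (fun θ => z.im * ((1 + linePoint θ ^ 2) * ‖(z - linePoint θ)⁻¹‖ ^ 2)) Aᶜ := fun θ hθ =>
    poissonKernel_cayley hz (circleMap_eq_linePoint hθ)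
  refine ⟨hi.integrableOn.congr_fun hc hA.compl, ?_⟩
  have h1 := h _ hw
  rw [cayley_cayley hz, ← integral_add_compl hA hi, setIntegral_congr_fun hA.compl hc,
    setIntegral_congr_fun (g := fun _ => z.im) hA
      (fun θ hθ => poissonKernel_cayley_of_eq_one hz hθ)] at h1
  simpa using h1

/-- A Nevanlinna-type criterion for a function to be a Cauchy transform. -/
theorem exists_cauchyG_eq {g : ℂ → ℂ} (hg : DifferentiableOn ℂ g UHP)
    (him : ∀ z ∈ UHP, (g z).im ≤ 0)
    (hlim : Tendsto (fun y : ℝ => y * I * g (y * I)) atTop (𝓝 1)) :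
    ∃ κ : Measure ℝ, IsProbabilityMeasure κ ∧ ∀ z ∈ UHP, cauchyG κ z = g z := by
  obtain ⟨σ, m, hσ, hm, h⟩ := exists_integral_eq_neg_im hg him
  have hlim' : Tendsto (fun n : ℕ => ((n : ℝ) + 1) * -(g (((n + 1 : ℝ) : ℂ) * I)).im) atTop (𝓝 1) := by
    have h1 : Tendsto (fun n : ℕ => (n : ℝ) + 1) atTop atTop :=
      tendsto_atTop_add_const_right _ _ tendsto_natCast_atTop_atTop
    have h2 := (continuous_re.tendsto _).comp (hlim.comp h1)
    refine (h2.congr fun n => ?_)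
    simp
  have hmem : ∀ n : ℕ, (((n + 1 : ℝ) : ℂ) * I) ∈ UHP := fun n => by
    simp [UHP]; positivity
  let F : ℕ → ℝ → ℝ := fun n θ => ((n : ℝ) + 1) ^ 2 * ((1 + linePoint θ ^ 2) *
    ‖(((n + 1 : ℝ) : ℂ) * I - linePoint θ)⁻¹‖ ^ 2)
  have hF : ∀ n, Integrable (F n) σ ∧
      m * ((n : ℝ) + 1) ^ 2 + ∫ θ, F n θ ∂σ = ((n : ℝ) + 1) * -(g (((n + 1 : ℝ) : ℂ) * I)).im := by
    intro n
    obtain ⟨h1, h2⟩ := h _ (hmem n)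
    have h3 : F n = fun θ => ((n : ℝ) + 1) * ((((n + 1 : ℝ) : ℂ) * I).im *
        ((1 + linePoint θ ^ 2) * ‖(((n + 1 : ℝ) : ℂ) * I - linePoint θ)⁻¹‖ ^ 2)) := by
      ext θ; simp [F]; ring
    rw [h3]
    refine ⟨h1.const_mul _, ?_⟩
    rw [← h2, integral_const_mul, mul_add]
    simp; ring
  have hFeq : ∀ n θ, F n θ = (1 + linePoint θ ^ 2) *
      (((n : ℝ) + 1) ^ 2 / (((n : ℝ) + 1) ^ 2 + linePoint θ ^ 2)) := by
    intro n θ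
    have : ‖(((n + 1 : ℝ) : ℂ) * I - linePoint θ)⁻¹‖ ^ 2
        = (((n : ℝ) + 1) ^ 2 + linePoint θ ^ 2)⁻¹ := by
      rw [norm_inv, inv_pow, ← normSq_eq_norm_sq, normSq_apply]
      simp; ring
    simp only [F, this]
    ring
  have hF0 : ∀ n θ, 0 ≤ F n θ := fun n θ => by positivity
  have hm0 : m = 0 := by
    refine le_antisymm ?_ hm
    have h1 : Tendsto (fun n : ℕ => ((n : ℝ) + 1) ^ 2) atTop atTop :=
      (tendsto_pow_atTop two_ne_zero).comp
        (tendsto_atTop_add_const_right _ _ tendsto_natCast_atTop_atTop)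
    refine ge_of_tendsto (hlim'.div_atTop h1) (Eventually.of_forall fun n => ?_)
    rw [le_div_iff₀ (by positivity), ← (hF n).2]
    linarith [integral_nonneg (μ := σ) (f := F n) (hF0 n)]
  have hmass : ∫⁻ θ, ENNReal.ofReal (1 + linePoint θ ^ 2) ∂σ = 1 := by
    have h1 : Tendsto (fun n => ∫⁻ θ, ENNReal.ofReal (F n θ) ∂σ) atTop
        (𝓝 (∫⁻ θ, ENNReal.ofReal (1 + linePoint θ ^ 2) ∂σ)) := by
      refine lintegral_tendsto_of_tendsto_of_monotone
        (fun n => (hF n).1.aestronglyMeasurable.aemeasurable.ennreal_ofReal)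
        (Eventually.of_forall fun θ => ?_) (Eventually.of_forall fun θ => ?_)
      · intro n k hnk
        refine ENNReal.ofReal_le_ofReal ?_
        rw [hFeq, hFeq]
        have : (n : ℝ) ≤ k := by exact_mod_cast hnk
        gcongr ?_ * ?_
        rw [div_le_div_iff₀ (by positivity) (by positivity)]
        have : ((n : ℝ) + 1) ^ 2 ≤ ((k : ℝ) + 1) ^ 2 := by gcongr
        nlinarith [sq_nonneg (linePoint θ)]
      · refine (ENNReal.continuous_ofReal.tendsto _).comp ?_
        simp only [hFeq]
        have h1 : Tendsto (fun n : ℕ => ((n : ℝ) + 1) ^ 2) atTop atTop :=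
          (tendsto_pow_atTop two_ne_zero).comp
            (tendsto_atTop_add_const_right _ _ tendsto_natCast_atTop_atTop)
        have h2 : Tendsto (fun n : ℕ => 1 - linePoint θ ^ 2 / (((n : ℝ) + 1) ^ 2 + linePoint θ ^ 2))
            atTop (𝓝 (1 - 0)) :=
          tendsto_const_nhds.sub (tendsto_const_nhds.div_atTop
            (tendsto_atTop_add_const_right _ _ h1))
        have h3 := h2.const_mul (1 + linePoint θ ^ 2)
        rw [sub_zero, mul_one] at h3
        refine h3.congr fun n => ?_
        have : 0 < ((n : ℝ) + 1) ^ 2 + linePoint θ ^ 2 := by positivity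
        field_simp
        ring
    have h2 : Tendsto (fun n => ∫⁻ θ, ENNReal.ofReal (F n θ) ∂σ) atTop (𝓝 1) := by
      rw [← ENNReal.ofReal_one]
      refine ((ENNReal.continuous_ofReal.tendsto _).comp hlim').congr fun n => ?_
      rw [Function.comp_apply, ← (hF n).2, hm0, zero_mul, zero_add,
        ofReal_integral_eq_lintegral_ofReal (hF n).1 (Eventually.of_forall (hF0 n))]
    exact tendsto_nhds_unique h1 h2
  have hdens : Measurable fun θ => ENNReal.ofReal (1 + linePoint θ ^ 2) :=
    (measurable_const.add (measurable_linePoint.pow_const 2)).ennreal_ofReal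
  let τ : Measure ℝ := σ.withDensity fun θ => ENNReal.ofReal (1 + linePoint θ ^ 2)
  have hτ : IsProbabilityMeasure τ := ⟨by
    rw [withDensity_apply _ MeasurableSet.univ, Measure.restrict_univ, hmass]⟩
  have hκ : IsProbabilityMeasure (τ.map linePoint) :=
    Measure.isProbabilityMeasure_map measurable_linePoint.aemeasurable
  refine ⟨τ.map linePoint, hκ, ?_⟩
  refine eqOn_of_im_eq (differentiableOn_cauchyG _) hg (fun z hz => ?_) ?_ ?_
  · have hm : AEStronglyMeasurable (fun x : ℝ => ‖(z - x)⁻¹‖ ^ 2) (τ.map linePoint) :=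
      ((continuous_inv_sub_ofReal hz).norm.pow 2).aestronglyMeasurable
    rw [im_cauchyG _ hz, neg_eq_iff_eq_neg, ← (h z hz).2, hm0, zero_mul, zero_add,
      integral_const_mul, integral_map measurable_linePoint.aemeasurable hm,
      integral_withDensity_eq_integral_toReal_smul hdens
        (Eventually.of_forall fun _ => ENNReal.ofReal_lt_top)]
    congr 1
    refine integral_congr_ae (Eventually.of_forall fun θ => ?_)
    dsimp only
    rw [ENNReal.toReal_ofReal (by positivity), smul_eq_mul]
  · refine squeeze_zero_norm' ?_ tendsto_inv_atTop_zero
    filter_upwards [eventually_gt_atTop 0] with y hy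
    simpa using norm_cauchyG_le (τ.map linePoint) (z := y * I) (by simpa using hy)
  · have h1 : Tendsto (fun y : ℝ => ((y : ℂ) * I)⁻¹) atTop (𝓝 0) := by
      refine squeeze_zero_norm' ?_ tendsto_inv_atTop_zero
      filter_upwards [eventually_gt_atTop 0] with y hy
      simp [abs_of_pos hy]
    have h2 := h1.mul hlim
    rw [zero_mul] at h2
    refine h2.congr' ?_
    filter_upwards [eventually_gt_atTop 0] with y hy
    have : (y : ℂ) ≠ 0 := by exact_mod_cast hy.ne'
    have := I_ne_zero
    field_simp

lemma exists_eq_of_norm_sub_le {F : ℂ → ℂ} {c u : ℂ} {r : ℝ} (hr : 0 < r)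
    (hd : DifferentiableOn ℂ F (ball c (2 * r)))
    (hC : ∀ z ∈ ball c (2 * r), ‖F z - z‖ ≤ r / 8) (hu : ‖u - c‖ ≤ r / 8) :
    ∃ v ∈ ball c r, F v = u := by
  have hsub : closedBall c r ⊆ ball c (2 * r) := closedBall_subset_ball (by linarith)
  have hc : c ∈ ball c r := mem_ball_self hr
  have hlow : ∀ z ∈ ball c r, ‖z - c‖ / 2 ≤ ‖F z - F c‖ := by
    intro z hz
    have h1 := norm_sub_le_of_norm_le_on_ball (f := fun z => F z - z) hr (hd.sub differentiableOn_id)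
      hC hz hc
    have h2 := norm_sub_le (F z - F c) (F z - z - (F c - c))
    rw [show F z - F c - (F z - z - (F c - c)) = z - c by ring] at h2
    rw [show r / 8 / r = 1 / 8 by field_simp] at h1
    linarith [norm_nonneg (z - c)]
  have himg := DiffContOnCl.ball_subset_image_closedBall (f := F) (z₀ := c) (r := r) (ε := 3 / 4 * r)
    ((hd.mono hsub).diffContOnCl_ball subset_rfl) hr ?_ ?_
  · obtain ⟨v, hv, rfl⟩ := himg (show u ∈ ball (F c) (3 / 4 * r / 2) by
      rw [mem_ball_iff_norm]
      have h1 := hC c (hsub (mem_closedBall_self hr.le))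
      have h2 := norm_sub_le (u - c) (F c - c)
      rw [show u - c - (F c - c) = u - F c by ring] at h2
      linarith)
    refine ⟨v, ?_, rfl⟩
    have h1 := norm_sub_le (F v - c) (F v - v)
    rw [show F v - c - (F v - v) = v - c by ring] at h1
    rw [mem_ball_iff_norm]
    linarith [hC v (hsub hv)]
  · intro z hz
    have hz' : ‖z - c‖ = r := by simpa [dist_eq_norm] using hz
    have h1 := hC z (hsub (sphere_subset_closedBall hz))
    have h2 := hC c (hsub (mem_closedBall_self hr.le))
    have h3 := norm_add_le (F z - F c) (-(F z - z) + (F c - c))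
    have h4 := norm_add_le (-(F z - z)) (F c - c)
    rw [norm_neg] at h4
    rw [show F z - F c + (-(F z - z) + (F c - c)) = z - c by ring, hz'] at h3
    linarith
  · have : ∀ᶠ z in 𝓝[≠] c, F z ≠ F c := by
      filter_upwards [self_mem_nhdsWithin, mem_nhdsWithin_of_mem_nhds (ball_mem_nhds c hr)]
        with z hz hzr h
      have h1 := hlow z hzr
      rw [h, sub_self, norm_zero] at h1
      have h2 : 0 < ‖z - c‖ := norm_pos_iff.2 (sub_ne_zero.2 hz)
      linarith
    exact this.frequently.filter_mono nhdsWithin_le_nhds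

lemma tcone_anti {α β M N : ℝ} (hα : α ≤ β) (hN : 0 ≤ N) (hM : N ≤ M) :
    tcone α M ⊆ tcone β N := fun _ hz =>
  ⟨hz.1.trans_le (mul_le_mul_of_nonneg_right hα (hN.trans (hM.trans hz.2.le))), hM.trans_lt hz.2⟩

lemma isOpen_tcone (α M : ℝ) : IsOpen (tcone α M) :=
  (isOpen_lt continuous_re.abs (continuous_const.mul continuous_im)).inter
    (isOpen_lt continuous_const continuous_im)

lemma ofReal_mul_I_mem_tcone {α M y : ℝ} (hα : 0 < α) (hM : 0 < M) (hy : M < y) :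
    (y : ℂ) * I ∈ tcone α M := by
  simpa [tcone, hy] using mul_pos hα (hM.trans hy)

lemma mem_tcone_of_norm_sub_le {a M δ : ℝ} (ha : 0 < a) (hM : 0 < M) (hδ : δ * (1 + a) ≤ a / 2)
    {z w : ℂ} (hz : z ∈ tcone (a / 2) (2 * M)) (hw : ‖w - z‖ ≤ δ * z.im) : w ∈ tcone a M := by
  have hy : 0 < z.im := lt_trans (by positivity) hz.2
  have h1 := (abs_re_le_norm (w - z)).trans hw
  have h2 := (abs_im_le_norm (w - z)).trans hw
  rw [sub_re] at h1
  rw [sub_im] at h2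
  have h3 := (abs_le.1 h2).1
  have h4 : |w.re| < a / 2 * z.im + δ * z.im := by
    have := abs_add_le (w.re - z.re) z.re
    rw [sub_add_cancel] at this
    linarith [hz.1]
  have h5 : δ ≤ 1 / 2 := by
    by_contra! h
    nlinarith
  refine ⟨?_, ?_⟩
  · nlinarith
  · nlinarith [hz.2]

/-- The iterates approximating the subordination function of `μ ⊞ ν` with respect to `ν`. -/
def subordIter (μ ν : Measure ℝ) : ℕ → ℂ → ℂ
  | 0, z => z
  | n + 1, z =>
    let p := z + (Ftr ν (subordIter μ ν n z) - subordIter μ ν n z)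
    z + (Ftr μ p - p)

lemma im_le_im_add_Ftr_sub (μ : Measure ℝ) [IsProbabilityMeasure μ] {z w : ℂ} (hw : 0 < w.im) :
    z.im ≤ (z + (Ftr μ w - w)).im := by
  have := im_le_im_Ftr μ hw
  simp only [add_im, sub_im]
  linarith

lemma im_le_im_subordIter (μ ν : Measure ℝ) [IsProbabilityMeasure μ] [IsProbabilityMeasure ν]
    (n : ℕ) {z : ℂ} (hz : 0 < z.im) : z.im ≤ (subordIter μ ν n z).im := by
  induction n with
  | zero => exact le_rfl
  | succ n ih =>
    exact im_le_im_add_Ftr_sub μ (hz.trans_le (im_le_im_add_Ftr_sub ν (hz.trans_le ih)))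

lemma differentiableOn_subordIter (μ ν : Measure ℝ) [IsProbabilityMeasure μ]
    [IsProbabilityMeasure ν] (n : ℕ) : DifferentiableOn ℂ (subordIter μ ν n) UHP := by
  induction n with
  | zero => exact differentiableOn_id
  | succ n ih =>
    have hmaps : MapsTo (subordIter μ ν n) UHP UHP := fun z (hz : 0 < z.im) =>
      hz.trans_le (im_le_im_subordIter μ ν n hz)
    have hp := differentiableOn_id.add (((differentiableOn_Ftr ν).comp ih hmaps).sub ih)
    refine differentiableOn_id.add (((differentiableOn_Ftr μ).comp hp fun z hz => ?_).sub hp)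
    exact lt_of_lt_of_le hz (im_le_im_add_Ftr_sub ν (hmaps hz))

/-- On a deep truncated cone the subordination iterates converge. -/
lemma exists_tendsto_subordIter {μ ν c : Measure ℝ} [IsProbabilityMeasure μ]
    [IsProbabilityMeasure ν] [IsProbabilityMeasure c] {φ ψ : ℂ → ℂ} (hμ : IsVT μ φ)
    (hν : IsVT ν ψ) (hc : IsVT c fun z => φ z + ψ z) :
    ∃ α, 0 < α ∧ ∀ ε, 0 < ε → ∃ M, 0 < M ∧ ∀ z ∈ tcone α M, ∃ w, ‖w - z‖ ≤ ε * z.im ∧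
      Ftr ν w = Ftr c z ∧ φ (Ftr c z) + w = z ∧
      Tendsto (fun n => subordIter μ ν n z) atTop (𝓝 w) := by
  obtain ⟨α₁, M₁, hα₁, hM₁, h₁⟩ := hμ
  obtain ⟨α₂, M₂, hα₂, hM₂, h₂⟩ := hν
  obtain ⟨α₃, M₃, hα₃, hM₃, h₃⟩ := hc
  set a := min (min α₁ α₂) α₃ with ha_def
  have ha : 0 < a := by positivity
  refine ⟨a / 2, by positivity, fun ε hε => ?_⟩
  set δ := min ε (a / (4 * (1 + a))) with hδ_def
  have hδ : 0 < δ := by positivity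
  have hδa : 2 * δ * (1 + a) ≤ a / 2 := by
    calc 2 * δ * (1 + a) ≤ 2 * (a / (4 * (1 + a))) * (1 + a) := by
          gcongr
          exact min_le_right _ _
      _ = a / 2 := by field_simp; norm_num
  have hδ1 : 2 * δ ≤ 1 := by
    by_contra! h
    nlinarith
  obtain ⟨N₁, hN₁, k₁⟩ := exists_norm_Ftr_sub_le μ ha (show 0 < δ / 16 by positivity)
  obtain ⟨N₂, hN₂, k₂⟩ := exists_norm_Ftr_sub_le ν ha (show 0 < δ / 16 by positivity)
  obtain ⟨N₃, hN₃, k₃⟩ := exists_norm_Ftr_sub_le c ha (show 0 < δ / 16 by positivity)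
  set M := M₁ + M₂ + M₃ + N₁ + N₂ + N₃ with hM_def
  have hM : 0 < M := by positivity
  refine ⟨2 * M, by positivity, fun z hz => ?_⟩
  have hy : 0 < z.im := lt_trans (by positivity) hz.2
  set r := δ * z.im with hr_def
  have hr : 0 < r := by positivity
  have hball : ∀ w ∈ ball z (2 * r), w ∈ tcone a M ∧ w.im ≤ 2 * z.im := by
    intro w hw
    have hw' : ‖w - z‖ ≤ 2 * δ * z.im := by
      rw [mul_assoc]
      exact (mem_ball_iff_norm.1 hw).le
    refine ⟨mem_tcone_of_norm_sub_le ha hM hδa hz hw', ?_⟩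
    have h := (le_abs_self _).trans ((abs_im_le_norm (w - z)).trans hw')
    rw [sub_im] at h
    nlinarith
  have hcone : ∀ {α N : ℝ}, a ≤ α → 0 < N → N ≤ M → ∀ w ∈ ball z (2 * r), w ∈ tcone α N :=
    fun hα hN hNM w hw => tcone_anti hα hN.le hNM (hball w hw).1
  have hUHP : ball z (2 * r) ⊆ UHP := fun w hw => tcone_subset_UHP hM (hball w hw).1
  have hest : ∀ (ρ : Measure ℝ) (N : ℝ), 0 < N → N ≤ M →
      (∀ w ∈ tcone a N, ‖Ftr ρ w - w‖ ≤ δ / 16 * w.im) →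
      ∀ w ∈ ball z (2 * r), ‖Ftr ρ w - w‖ ≤ r / 8 := by
    intro ρ N hN hNM h w hw
    refine (h w (hcone le_rfl hN hNM w hw)).trans ?_
    calc δ / 16 * w.im ≤ δ / 16 * (2 * z.im) := by
          gcongr
          exact (hball w hw).2
      _ = r / 8 := by rw [hr_def]; ring
  have e₁ := hest μ N₁ hN₁ (by linarith) k₁
  have e₂ := hest ν N₂ hN₂ (by linarith) k₂
  have hz2 : z ∈ ball z (2 * r) := mem_ball_self (by positivity)
  have hu := hest c N₃ hN₃ (by linarith) k₃ z hz2
  have d₁ := (differentiableOn_Ftr μ).mono hUHP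
  have d₂ := (differentiableOn_Ftr ν).mono hUHP
  have hrr : ball z r ⊆ ball z (2 * r) := ball_subset_ball (by linarith)
  obtain ⟨v, hv, hvu⟩ := exists_eq_of_norm_sub_le hr d₁ e₁ hu
  obtain ⟨w, hw, hwu⟩ := exists_eq_of_norm_sub_le hr d₂ e₂ hu
  have g₁ := h₁ v (hcone (by simp [ha_def]) hM₁ (by linarith) v (hrr hv))
  have g₂ := h₂ w (hcone (by simp [ha_def]) hM₂ (by linarith) w (hrr hw))
  have g₃ := h₃ z (hcone (by simp [ha_def]) hM₃ (by linarith) z hz2)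
  rw [hvu] at g₁
  rw [hwu] at g₂
  refine ⟨w, (mem_ball_iff_norm.1 hw).le.trans ?_, hwu, by linear_combination g₃ - g₂, ?_⟩
  · rw [hr_def]
    gcongr
    exact min_le_left _ _
  have hmem : ∀ {ρ : Measure ℝ}, (∀ x ∈ ball z (2 * r), ‖Ftr ρ x - x‖ ≤ r / 8) →
      ∀ x ∈ ball z r, z + (Ftr ρ x - x) ∈ ball z r := fun h x hx => by
    rw [mem_ball_iff_norm, add_sub_cancel_left]
    linarith [h x (hrr hx)]
  have hlip : ∀ {ρ : Measure ℝ}, DifferentiableOn ℂ (Ftr ρ) (ball z (2 * r)) →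
      (∀ x ∈ ball z (2 * r), ‖Ftr ρ x - x‖ ≤ r / 8) → ∀ x ∈ ball z r, ∀ y ∈ ball z r,
      ‖(z + (Ftr ρ x - x)) - (z + (Ftr ρ y - y))‖ ≤ 1 / 8 * ‖x - y‖ := fun d h x hx y hy => by
    have h1 := norm_sub_le_of_norm_le_on_ball hr (d.sub differentiableOn_id) h hx hy
    rw [show r / 8 / r = 1 / 8 by field_simp] at h1
    rwa [add_sub_add_left_eq_sub]
  have hfix₁ : z + (Ftr μ v - v) = w := by rw [hvu]; linear_combination g₂ + g₁ - g₃
  have hfix₂ : z + (Ftr ν w - w) = v := by rw [hwu]; linear_combination g₂ + g₁ - g₃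
  have hiter : ∀ n, subordIter μ ν n z ∈ ball z r ∧
      ‖subordIter μ ν n z - w‖ ≤ (1 / 64) ^ n * ‖z - w‖ := by
    intro n
    induction n with
    | zero => exact ⟨mem_ball_self hr, by simp [subordIter]⟩
    | succ n ih =>
      have hp := hmem e₂ _ ih.1
      refine ⟨hmem e₁ _ hp, ?_⟩
      have l₂ := hlip d₂ e₂ _ ih.1 _ hw
      have l₁ := hlip d₁ e₁ _ hp _ hv
      rw [hfix₂] at l₂
      rw [hfix₁] at l₁
      refine l₁.trans ?_
      rw [pow_succ]
      linarith [ih.2]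
  rw [tendsto_iff_norm_sub_tendsto_zero]
  refine squeeze_zero (fun _ => norm_nonneg _) (fun n => (hiter n).2) ?_
  simpa using (tendsto_pow_atTop_nhds_zero_of_lt_one (by norm_num : (0 : ℝ) ≤ 1 / 64)
    (by norm_num)).mul_const ‖z - w‖

/-- Existence of the subordination distribution. -/
theorem exists_subordination {μ ν c : Measure ℝ} [IsProbabilityMeasure μ]
    [IsProbabilityMeasure ν] [IsProbabilityMeasure c] {φ ψ : ℂ → ℂ} (hμ : IsVT μ φ)
    (hν : IsVT ν ψ) (hc : IsVT c fun z => φ z + ψ z) :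
    ∃ κ : Measure ℝ, IsProbabilityMeasure κ ∧ IsVT κ (fun z => φ (Ftr ν z)) ∧
      ∀ z ∈ UHP, cauchyG c z = cauchyG ν (Ftr κ z) := by
  obtain ⟨α, hα, h⟩ := exists_tendsto_subordIter hμ hν hc
  have hpos : ∀ n, ∀ z ∈ UHP, 0 < (subordIter μ ν n z).im := fun n z (hz : 0 < z.im) =>
    hz.trans_le (im_le_im_subordIter μ ν n hz)
  obtain ⟨U, g, hU, hg, hlim⟩ := exists_ultrafilter_limit
    (f := fun n z => (subordIter μ ν n z)⁻¹)
    (fun n => (differentiableOn_subordIter μ ν n).inv fun z hz h0 => by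
      have := hpos n z hz
      simp [h0] at this)
    (fun n z (hz : 0 < z.im) => by
      rw [norm_inv]
      exact inv_anti₀ hz ((im_le_im_subordIter μ ν n hz).trans
        ((le_abs_self _).trans (abs_im_le_norm _))))
  have hg_eq : ∀ z ∈ UHP, ∀ w, Tendsto (fun n => subordIter μ ν n z) atTop (𝓝 w) →
      z.im ≤ ‖w‖ ∧ g z = w⁻¹ := by
    intro z hz w hw
    have h1 : z.im ≤ ‖w‖ := (ge_of_tendsto ((continuous_im.tendsto _).comp hw)
      (Eventually.of_forall fun n => im_le_im_subordIter μ ν n hz)).trans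
        ((le_abs_self _).trans (abs_im_le_norm _))
    have h2 : w ≠ 0 := norm_pos_iff.1 (lt_of_lt_of_le hz h1)
    exact ⟨h1, tendsto_nhds_unique (hlim z hz) ((hw.inv₀ h2).mono_left hU)⟩
  obtain ⟨κ, hκ, hκg⟩ := exists_cauchyG_eq hg
    (fun z hz => le_of_tendsto ((continuous_im.tendsto _).comp (hlim z hz))
      (Eventually.of_forall fun n => by
        have := hpos n z hz
        simp only [Function.comp_apply, inv_im]
        exact div_nonpos_of_nonpos_of_nonneg (by linarith) (normSq_nonneg _)))
    (by
      rw [Metric.tendsto_atTop]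
      intro ε hε
      obtain ⟨M, hM, hz⟩ := h (ε / 2) (by positivity)
      refine ⟨M + 1, fun y hy => ?_⟩
      have hy0 : 0 < y := by linarith
      have hyU : (y : ℂ) * I ∈ UHP := by simpa [UHP] using hy0
      obtain ⟨w, hw, -, -, hwlim⟩ := hz _ (ofReal_mul_I_mem_tcone hα hM (by linarith : M < y))
      obtain ⟨h1, h2⟩ := hg_eq _ hyU w hwlim
      have h3 : 0 < ‖w‖ := lt_of_lt_of_le hyU h1
      have h4 : w ≠ 0 := norm_pos_iff.1 h3
      rw [dist_eq_norm, h2, show (y : ℂ) * I * w⁻¹ - 1 = -(w - y * I) / w by field_simp; ring,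
        norm_div, norm_neg, div_lt_iff₀ h3]
      refine hw.trans_lt ?_
      have h5 : (((y : ℂ) * I).im) = y := by simp
      rw [h5] at h1 ⊢
      nlinarith)
  obtain ⟨M, hM, hz⟩ := h 1 one_pos
  have hcone : ∀ z ∈ tcone α M, Ftr ν (Ftr κ z) = Ftr c z ∧ φ (Ftr c z) + Ftr κ z = z := by
    intro z hzc
    obtain ⟨w, -, h1, h2, h3⟩ := hz z hzc
    have hzU := tcone_subset_UHP hM hzc
    have h4 : Ftr κ z = w := by
      rw [Ftr, hκg z hzU, (hg_eq z hzU w h3).2, inv_inv]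
    rw [h4]
    exact ⟨h1, h2⟩
  have hmaps : MapsTo (Ftr κ) UHP UHP := fun z (hz : 0 < z.im) => hz.trans_le (im_le_im_Ftr κ hz)
  have hmem : (((M + 1 : ℝ) : ℂ) * I) ∈ tcone α M := ofReal_mul_I_mem_tcone hα hM (by linarith)
  have hcomp : EqOn (Ftr ν ∘ Ftr κ) (Ftr c) UHP := by
    refine AnalyticOnNhd.eqOn_of_preconnected_of_eventuallyEq
      (((differentiableOn_Ftr ν).comp (differentiableOn_Ftr κ) hmaps).analyticOnNhd UHP_isOpen)
      ((differentiableOn_Ftr c).analyticOnNhd UHP_isOpen) UHP_isPreconnected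
      (tcone_subset_UHP hM hmem) ?_
    filter_upwards [(isOpen_tcone α M).mem_nhds hmem] with z hz
    exact (hcone z hz).1
  refine ⟨κ, hκ, ⟨α, M, hα, hM, fun z hz => ?_⟩, fun z hz => inv_injective (hcomp hz).symm⟩
  dsimp only
  rw [(hcone z hz).1]
  exact (hcone z hz).2

lemma isVT_of_subordination {ν c s : Measure ℝ} [IsProbabilityMeasure s] {φ ψ : ℂ → ℂ}
    (hν : IsVT ν ψ) (hc : IsVT c fun z => φ z + ψ z)
    (hs : ∀ z ∈ UHP, cauchyG c z = cauchyG ν (Ftr s z)) :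
    IsVT s fun z => φ (Ftr ν z) := by
  obtain ⟨α₁, M₁, hα₁, hM₁, h₁⟩ := hν
  obtain ⟨α₂, M₂, hα₂, hM₂, h₂⟩ := hc
  set a := min α₁ α₂ with ha_def
  have ha : 0 < a := by positivity
  obtain ⟨N, hN, h⟩ := exists_norm_Ftr_sub_le s ha (show 0 < a / (2 * (1 + a)) by positivity)
  set M := M₁ + M₂ + N
  have hM : 0 < M := by positivity
  refine ⟨a / 2, 2 * M, by positivity, by positivity, fun z hz => ?_⟩
  have hz' : z ∈ tcone a M := tcone_anti (by linarith) hM.le (by linarith) hz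
  have hFs : Ftr s z ∈ tcone a M := mem_tcone_of_norm_sub_le ha hM
    (δ := a / (2 * (1 + a))) (by field_simp; norm_num) hz
    (h z (tcone_anti le_rfl hN.le (by simp only [M]; linarith) hz'))
  have g₁ := h₁ _ (tcone_anti (min_le_left _ _) hM₁.le (by simp only [M]; linarith) hFs)
  have g₂ := h₂ z (tcone_anti (min_le_right _ _) hM₂.le (by simp only [M]; linarith) hz')
  have hF : Ftr ν (Ftr s z) = Ftr c z := by
    rw [Ftr, ← hs z (tcone_subset_UHP hM hz'), Ftr]
  dsimp only
  rw [hF] at g₁ ⊢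
  linear_combination g₂ - g₁

end

/-- If `μ` is ⊞-infinitely divisible (with semigroup `μpow t = μ^{⊞t}`,
`conv t = μ^{⊞t} ⊞ ν`) and `sub = μ ⊳ ν`, then `sub` is ⊞-infinitely divisible and for all
`t ≥ 0`, `(μ ⊳ ν)^{⊞t} = μ^{⊞t} ⊳ ν`. -/
theorem stmt2
    (μ ν : Measure ℝ) (hμ : IsProbabilityMeasure μ) (hν : IsProbabilityMeasure ν)
    (φμ φν : ℂ → ℂ) (hφμ : IsVT μ φμ) (hφν : IsVT ν φν)
    (μpow : ℝ → Measure ℝ) (hpow : ∀ t : ℝ, 0 ≤ t → IsProbabilityMeasure (μpow t))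
    (hpowVT : ∀ t : ℝ, 0 ≤ t → IsVT (μpow t) (fun z => (t : ℂ) * φμ z))
    (hone : μpow 1 = μ)
    (conv : ℝ → Measure ℝ) (hconv : ∀ t : ℝ, 0 ≤ t → IsProbabilityMeasure (conv t))
    (hconvVT : ∀ t : ℝ, 0 ≤ t → IsVT (conv t) (fun z => (t : ℂ) * φμ z + φν z))
    (sub : Measure ℝ) (hsubprob : IsProbabilityMeasure sub)
    (hsub : ∀ z ∈ UHP, cauchyG (conv 1) z = cauchyG ν (Ftr sub z)) :
    ∃ φs : ℂ → ℂ, IsVT sub φs ∧ ∀ t : ℝ, 0 ≤ t →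
      ∃ κ : Measure ℝ, IsProbabilityMeasure κ ∧ IsVT κ (fun z => (t : ℂ) * φs z) ∧
        ∀ z ∈ UHP, cauchyG (conv t) z = cauchyG ν (Ftr κ z) := by
  refine ⟨fun z => φμ (Ftr ν z), ?_, fun t ht => ?_⟩
  · have h := hconvVT 1 zero_le_one
    simp only [ofReal_one, one_mul] at h
    exact isVT_of_subordination hφν h hsub
  · have := hpow t ht
    have := hconv t ht
    exact exists_subordination (hpowVT t ht) hφν (hconvVT t ht)
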